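/- Let G = SO*(2n) (real rank r = ⌊n/2⌋) and let L(λ) be a unitarizable highest weight Harish-Chandra module of G with highest weight λ−ρ = λ₀ + zξ. If z = (λ, β∨) = z_k := 2n − 3 − 2k for a nonnegative integer k, then V(L(λ)) = closure of O_{k(λ)} with k(λ) = r if k ≥ r and k(λ) = k if 0 ≤ k ≤ r − 1. In particular, in the proof: when Q(λ₀) = R(λ₀) is of type so*(2p), z ≥ p − 1 and z = 2n − 3 − 2k ≤ 2p − 3 with 1 ≤ k ≤ ⌊n/2⌋ − 1, the second column of P(λ⁻) has length exactly 2k + 1, whence k(λ) = ⌊q₂/2⌋ = k. -/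

import Mathlib

/-! ## The Robinson–Schensted insertion algorithm -/

section RS

variable {α : Type*} [LinearOrder α]

/-- Robinson–Schensted row insertion: insert `x` into a (weakly increasing) row,
bumping the first entry which is strictly greater than `x`. -/
def rowInsert : List α → α → List α × Option α
  | [], x => ([x], none)
  | y :: ys, x =>
    if x < y then (x :: ys, some y)
    else
      let p := rowInsert ys x
      (y :: p.1, p.2)

/-- Insert an entry into a tableau (recorded as its list of rows), bumping rows downwards. -/
def tableauInsert : List (List α) → α → List (List α)
  | [], x => [[x]]
  | r :: rs, x =>
    match rowInsert r x with
    | (r', none) => r' :: rs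
    | (r', some y) => r' :: tableauInsert rs y

/-- The Robinson–Schensted insertion tableau `P(w)` of a word `w`. -/
def RS (w : List α) : List (List α) := w.foldl tableauInsert []

/-- The shape `𝐩(w)` of the Robinson–Schensted tableau `P(w)`: its list of row lengths. -/
def RSshape (w : List α) : List ℕ := (RS w).map List.length

/-- The length of the `j`-th column (`j = 1, 2, …`) of the tableau `P(w)`. -/
def RScol (w : List α) (j : ℕ) : ℕ := ((RS w).filter fun r => j ≤ r.length).length

end RS

/-- For `λ = (t₁, …, tₙ)`, the sequence `λ⁻ = (t₁, …, tₙ, −tₙ, …, −t₁)`. -/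
def minusSeq {α : Type*} [Neg α] (w : List α) : List α := w ++ w.reverse.map (fun x => -x)


section TwoColumns

variable {α : Type*} [LinearOrder α]

/-- Insert a word into a row, returning the final row and the word of bumped entries. -/
def rowBump : List α → List α → List α × List α
  | r, [] => (r, [])
  | r, x :: w =>
    match rowInsert r x with
    | (r', none) => rowBump r' w
    | (r', some y) => ((rowBump r' w).1, y :: (rowBump r' w).2)

theorem foldl_tableauInsert_cons (r : List α) (rs : List (List α)) (w : List α) :
    w.foldl tableauInsert (r :: rs) =
      (rowBump r w).1 :: (rowBump r w).2.foldl tableauInsert rs := by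
  induction w generalizing r rs with
  | nil => simp [rowBump]
  | cons x w ih =>
    simp only [List.foldl_cons, rowBump, tableauInsert]
    rcases h : rowInsert r x with ⟨r', _ | y⟩
    · simp [ih]
    · simp [ih]

theorem tableauInsert_column (l : List α) (x : α) (h : (x :: l).Pairwise (· < ·)) :
    tableauInsert (l.map fun y => [y]) x = (x :: l).map fun y => [y] := by
  induction l generalizing x with
  | nil => simp [tableauInsert]
  | cons a l ih =>
    have hxa : x < a := (List.pairwise_cons.1 h).1 a (by simp)
    simp [tableauInsert, rowInsert, hxa, ih a (List.pairwise_cons.1 h).2]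

theorem foldl_tableauInsert_column (l w : List α)
    (h : (w.reverse ++ l).Pairwise (· < ·)) :
    w.foldl tableauInsert (l.map fun y => [y]) = (w.reverse ++ l).map fun y => [y] := by
  induction w generalizing l with
  | nil => simp
  | cons x w ih =>
    have h' : (w.reverse ++ (x :: l)).Pairwise (· < ·) := by simpa using h
    rw [List.foldl_cons, tableauInsert_column l x (List.pairwise_append.1 h').2.1, ih _ h']
    simp

/-- The word bumped out of the row `[a, b]` by a word `w` such that `b :: w` is strictly
decreasing and `a ≤ b`. -/
def bumpedWord (a : α) : α → List α → List α
  | _, [] => []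
  | b, c :: w => if c < a then a :: (c :: w).dropLast else b :: bumpedWord a c w

theorem rowBump_pair_of_lt (b c : α) (w : List α) (h : (c :: w).Pairwise (· > ·)) :
    (rowBump [c, b] w).1.length = 2 ∧ (rowBump [c, b] w).2 = (c :: w).dropLast := by
  induction w generalizing c with
  | nil => simp [rowBump]
  | cons d w ih =>
    have hdc : d < c := (List.pairwise_cons.1 h).1 d (by simp)
    have := ih d (List.pairwise_cons.1 h).2
    simp [rowBump, rowInsert, hdc, this]

theorem rowBump_pair (a b : α) (w : List α) (h : (b :: w).Pairwise (· > ·)) :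
    (rowBump [a, b] w).1.length = 2 ∧ (rowBump [a, b] w).2 = bumpedWord a b w := by
  induction w generalizing b with
  | nil => simp [rowBump, bumpedWord]
  | cons c w ih =>
    have hcb : c < b := (List.pairwise_cons.1 h).1 c (by simp)
    by_cases hca : c < a
    · have := rowBump_pair_of_lt b c w (List.pairwise_cons.1 h).2
      simp [rowBump, rowInsert, hca, this, bumpedWord]
    · have := ih c (List.pairwise_cons.1 h).2
      simp [rowBump, rowInsert, hca, hcb, this, bumpedWord]

theorem le_of_mem_bumpedWord {a b x : α} {w : List α} (hab : a ≤ b)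
    (h : (b :: w).Pairwise (· > ·)) (hx : x ∈ bumpedWord a b w) : x ≤ b := by
  induction w generalizing b with
  | nil => simp [bumpedWord] at hx
  | cons c w ih =>
    have hcb : c < b := (List.pairwise_cons.1 h).1 c (by simp)
    rw [bumpedWord] at hx
    split_ifs at hx with hca
    · rcases List.mem_cons.1 hx with rfl | hx
      · exact hab
      · exact ((List.pairwise_cons.1 h).1 x (List.dropLast_subset _ hx)).le
    · rcases List.mem_cons.1 hx with rfl | hx
      · exact le_rfl
      · exact (ih (not_lt.1 hca) (List.pairwise_cons.1 h).2 hx).trans hcb.le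

theorem pairwise_bumpedWord {a b : α} {w : List α} (h : (b :: w).Pairwise (· > ·)) :
    (bumpedWord a b w).Pairwise (· > ·) := by
  induction w generalizing b with
  | nil => simp [bumpedWord]
  | cons c w ih =>
    have hcb : c < b := (List.pairwise_cons.1 h).1 c (by simp)
    have hcw := (List.pairwise_cons.1 h).2
    rw [bumpedWord]
    split_ifs with hca
    · refine List.pairwise_cons.2 ⟨fun x hx => ?_, hcw.sublist (List.dropLast_sublist _)⟩
      rcases List.mem_cons.1 (List.dropLast_subset _ hx) with rfl | hx
      · exact hca
      · exact ((List.pairwise_cons.1 hcw).1 x hx).trans hca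
    · exact List.pairwise_cons.2
        ⟨fun x hx => (le_of_mem_bumpedWord (not_lt.1 hca) hcw hx).trans_lt hcb, ih hcw⟩

theorem bumpedWord_getElem?_of_le {a b x : α} {w : List α} {m i : ℕ}
    (h : (b :: w).Pairwise (· > ·)) (hm : (b :: w)[m]? = some x) (hx : a ≤ x) (hi : i < m) :
    (bumpedWord a b w)[i]? = (b :: w)[i]? := by
  induction w generalizing b m i with
  | nil => cases m <;> simp_all
  | cons c w ih =>
    obtain ⟨m, rfl⟩ := Nat.exists_eq_succ_of_ne_zero (by omega : m ≠ 0)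
    have hm' : (c :: w)[m]? = some x := by simpa using hm
    have hcw := (List.pairwise_cons.1 h).2
    have hxc : x ≤ c := by
      rcases List.mem_cons.1 (List.mem_of_getElem? hm') with rfl | hx
      · exact le_rfl
      · exact ((List.pairwise_cons.1 hcw).1 x hx).le
    rw [bumpedWord, if_neg (not_lt.2 (hx.trans hxc))]
    cases i with
    | zero => simp
    | succ i => simpa using ih hcw hm' (by omega)

theorem bumpedWord_getElem?_le {a b x : α} {w : List α} {i : ℕ} (hab : a ≤ b)
    (hx : (bumpedWord a b w)[i]? = some x) : ∃ y, (b :: w)[i]? = some y ∧ x ≤ y := by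
  induction w generalizing b i with
  | nil => simp [bumpedWord] at hx
  | cons c w ih =>
    rw [bumpedWord] at hx
    split_ifs at hx with hca
    · cases i with
      | zero => simp_all
      | succ i =>
        simp only [List.getElem?_cons_succ, List.getElem?_dropLast] at hx ⊢
        split_ifs at hx
        exact ⟨x, hx, le_rfl⟩
    · cases i with
      | zero => simp_all
      | succ i => exact ih (not_lt.1 hca) (by simpa using hx)

theorem exists_bumpedWord_getElem?_le {a b : α} {w : List α} {m : ℕ} (hab : a ≤ b)
    (hm : ∀ x, (b :: w)[m]? = some x → x < a) :
    ∃ i < m, ∀ x, (bumpedWord a b w)[i]? = some x → x ≤ a := by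
  induction w generalizing b m with
  | nil =>
    cases m with
    | zero => exact absurd (hm b (by simp)) (not_lt.2 hab)
    | succ m => exact ⟨0, by omega, by simp [bumpedWord]⟩
  | cons c w ih =>
    cases m with
    | zero => exact absurd (hm b (by simp)) (not_lt.2 hab)
    | succ m =>
      rw [bumpedWord]
      split_ifs with hca
      · exact ⟨0, by omega, by simp⟩
      · obtain ⟨i, hi, h⟩ := ih (m := m) (not_lt.1 hca) (by simpa using hm)
        exact ⟨i + 1, by omega, by simpa using h⟩

/-- The number of rows with at least two entries after inserting `w` into the one-column
tableau with entries `l`. -/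
def secondColumn (l w : List α) : ℕ :=
  ((w.foldl tableauInsert (l.map fun y => [y])).filter fun r => 2 ≤ r.length).length

theorem secondColumn_of_pairwise (l w : List α) (h : (w.reverse ++ l).Pairwise (· < ·)) :
    secondColumn l w = 0 := by
  rw [secondColumn, foldl_tableauInsert_column l w h]
  simp

theorem secondColumn_nil_left (w : List α) (h : w.Pairwise (· > ·)) : secondColumn [] w = 0 :=
  secondColumn_of_pairwise _ _ (by simpa [List.pairwise_reverse] using h)

theorem secondColumn_cons_of_lt {a b : α} {l w : List α} (hl : (a :: l).Pairwise (· < ·))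
    (hw : (b :: w).Pairwise (· > ·)) (hba : b < a) : secondColumn (a :: l) (b :: w) = 0 := by
  refine secondColumn_of_pairwise _ _
    (List.pairwise_append.2 ⟨List.pairwise_reverse.2 hw, hl, fun x hx y hy => ?_⟩)
  have hxb : x ≤ b := by
    rcases List.mem_cons.1 (List.mem_reverse.1 hx) with rfl | hx
    · exact le_rfl
    · exact ((List.pairwise_cons.1 hw).1 x hx).le
  have hay : a ≤ y := by
    rcases List.mem_cons.1 hy with rfl | hy
    · exact le_rfl
    · exact ((List.pairwise_cons.1 hl).1 y hy).le
  exact hxb.trans_lt (hba.trans_le hay)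

theorem secondColumn_cons_of_le {a b : α} {l w : List α} (hw : (b :: w).Pairwise (· > ·))
    (hab : a ≤ b) :
    secondColumn (a :: l) (b :: w) = secondColumn l (bumpedWord a b w) + 1 := by
  have h := rowBump_pair a b w hw
  simp [secondColumn, tableauInsert, rowInsert, not_lt.2 hab, foldl_tableauInsert_cons, h]

theorem le_secondColumn {l w : List α} {m : ℕ} (hl : l.Pairwise (· < ·))
    (hw : w.Pairwise (· > ·))
    (h : ∀ i j, i + j + 1 = m → ∃ x y, w[i]? = some x ∧ l[j]? = some y ∧ y ≤ x) :
    m ≤ secondColumn l w := by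
  induction l generalizing w m with
  | nil =>
    cases m with
    | zero => simp
    | succ m => simpa using h m 0 (by omega)
  | cons a l ih =>
    cases m with
    | zero => simp
    | succ m =>
      obtain ⟨x, y, hx, hy, hyx⟩ := h m 0 (by omega)
      obtain rfl : a = y := by simpa using hy
      cases w with
      | nil => simp at hx
      | cons b w =>
        have hxb : x ≤ b := by
          rcases List.mem_cons.1 (List.mem_of_getElem? hx) with rfl | hx
          · exact le_rfl
          · exact ((List.pairwise_cons.1 hw).1 x hx).le
        rw [secondColumn_cons_of_le hw (hyx.trans hxb)]
        refine Nat.succ_le_succ (ih (List.pairwise_cons.1 hl).2 (pairwise_bumpedWord hw) ?_)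
        intro i j hij
        obtain ⟨u, v, hu, hv, hvu⟩ := h i (j + 1) (by omega)
        refine ⟨u, v, ?_, by simpa using hv, hvu⟩
        rw [bumpedWord_getElem?_of_le hw hx hyx (by omega), hu]

theorem secondColumn_le_length {l w : List α} (hl : l.Pairwise (· < ·))
    (hw : w.Pairwise (· > ·)) : secondColumn l w ≤ l.length := by
  induction l generalizing w with
  | nil => simp [secondColumn_nil_left w hw]
  | cons a l ih =>
    cases w with
    | nil => simp [secondColumn_of_pairwise (a :: l) [] (by simpa using hl)]
    | cons b w =>
      rcases lt_or_ge b a with hba | hab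
      · simp [secondColumn_cons_of_lt hl hw hba]
      · rw [secondColumn_cons_of_le hw hab]
        exact Nat.succ_le_succ (ih (List.pairwise_cons.1 hl).2 (pairwise_bumpedWord hw))

theorem secondColumn_le {l w : List α} {i j : ℕ} {y : α} (hl : l.Pairwise (· < ·))
    (hw : w.Pairwise (· > ·)) (hy : l[j]? = some y) (h : ∀ x, w[i]? = some x → x < y) :
    secondColumn l w ≤ i + j := by
  induction l generalizing w i j y with
  | nil => simp at hy
  | cons a l ih =>
    cases w with
    | nil => simp [secondColumn_of_pairwise (a :: l) [] (by simpa using hl)]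
    | cons b w =>
      rcases lt_or_ge b a with hba | hab
      · simp [secondColumn_cons_of_lt hl hw hba]
      rw [secondColumn_cons_of_le hw hab]
      have hl' := (List.pairwise_cons.1 hl).2
      have hw' := pairwise_bumpedWord (a := a) hw
      cases j with
      | succ j =>
        refine Nat.succ_le_succ (ih hl' hw' (i := i) (j := j) (by simpa using hy) fun x hx => ?_)
        obtain ⟨x', hx', hle⟩ := bumpedWord_getElem?_le hab hx
        exact hle.trans_lt (h x' hx')
      | zero =>
        obtain rfl : a = y := by simpa using hy
        obtain ⟨i', hi', h'⟩ := exists_bumpedWord_getElem?_le hab h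
        rcases hv : l[i - 1 - i']? with _ | v
        · have := secondColumn_le_length hl' hw'
          have := List.getElem?_eq_none_iff.1 hv
          omega
        · have hav : a < v := (List.pairwise_cons.1 hl).1 v (List.mem_of_getElem? hv)
          have := ih hl' hw' hv fun x hx => (h' x hx).trans_lt hav
          omega

end TwoColumns

theorem RScol_two_minusSeq (l : List ℝ) (hl : l.Pairwise (· > ·)) :
    RScol (minusSeq l) 2 = secondColumn l.reverse (l.reverse.map fun x => -x) := by
  have h := foldl_tableauInsert_column [] l (by simpa [List.pairwise_reverse] using hl)
  simp only [List.map_nil, List.append_nil] at h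
  rw [RScol, RS, minusSeq, List.foldl_append, h, secondColumn]

theorem reverse_ofFn_getElem? {n : ℕ} (t : Fin n → ℝ) {a : ℕ} (ha : a < n) :
    (List.ofFn t).reverse[n - 1 - a]? = some (t ⟨a, ha⟩) := by
  rw [List.getElem?_reverse (by simp; omega)]
  simp [show n - 1 - (n - 1 - a) = a by omega, ha]

theorem RScol_two_minusSeq_ofFn {n k : ℕ} (t : Fin n → ℝ) (ht : StrictAnti t)
    (hle : ∀ i j : Fin n, n ≤ (i : ℕ) + j + 1 →
      t i + t j ≤ 2 * (n : ℝ) - 2 - 2 * k - ((i : ℕ) : ℝ) - ((j : ℕ) : ℝ))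
    (hpos : 2 * k + 1 < n → ∃ i j : Fin n, (i : ℕ) + j + 2 * k + 3 = 2 * n ∧ 0 < t i + t j) :
    RScol (minusSeq (List.ofFn t)) 2 = min n (2 * k + 1) := by
  have hl : (List.ofFn t).Pairwise (· > ·) :=
    List.pairwise_ofFn.2 fun i j hij => ht hij
  rw [RScol_two_minusSeq _ hl]
  have hasc : (List.ofFn t).reverse.Pairwise (· < ·) := List.pairwise_reverse.2 hl
  have hdesc : ((List.ofFn t).reverse.map fun x => -x).Pairwise (· > ·) :=
    List.pairwise_map.2 (hasc.imp fun h => neg_lt_neg h)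
  apply le_antisymm
  · refine le_min (by simpa using secondColumn_le_length hasc hdesc) ?_
    by_cases hk : 2 * k + 1 < n
    · obtain ⟨i, j, hij, h⟩ := hpos hk
      have := secondColumn_le hasc hdesc (reverse_ofFn_getElem? t j.2) (i := n - 1 - i)
        (by
          intro x hx
          rw [List.getElem?_map, reverse_ofFn_getElem? t i.2] at hx
          obtain rfl : -t i = x := by simpa using hx
          change -t i < t j
          linarith)
      omega
    · have := secondColumn_le_length hasc hdesc
      simp only [List.length_reverse, List.length_ofFn] at this
      omega
  · refine le_secondColumn hasc hdesc fun i j hij => ?_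
    have hi : n - 1 - i < n := by omega
    have hj : n - 1 - j < n := by omega
    have hi' := reverse_ofFn_getElem? t hi
    have hj' := reverse_ofFn_getElem? t hj
    rw [show n - 1 - (n - 1 - i) = i by omega] at hi'
    rw [show n - 1 - (n - 1 - j) = j by omega] at hj'
    refine ⟨_, _, by rw [List.getElem?_map, hi']; rfl, hj', ?_⟩
    have h := hle ⟨n - 1 - i, hi⟩ ⟨n - 1 - j, hj⟩ (by simp only; omega)
    have hcast : 2 * (n : ℝ) ≤ 2 + 2 * k + ((n - 1 - i : ℕ) : ℝ) + ((n - 1 - j : ℕ) : ℝ) := by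
      norm_cast
      omega
    simp only at h
    linarith

/-- Let `G = SO*(2n)` (real rank `r = ⌊n/2⌋`) and let `L(λ)` be a unitarizable highest
weight Harish-Chandra module of `G` with highest weight `λ − ρ = λ₀ + zξ`.  If
`z = (λ, β^∨) = z_k = 2n − 3 − 2k` for a nonnegative integer `k`, then
`V(L(λ)) = O̅_{k(λ)}` with `k(λ) = r` if `k ≥ r` and `k(λ) = k` if `0 ≤ k ≤ r − 1`,
i.e. `k(λ) = min {k, ⌊n/2⌋}`.  In particular, when `Q(λ₀) = R(λ₀)` is of type
`so*(2p)`, `z ≥ p − 1` and `z = 2n − 3 − 2k ≤ 2p − 3` with `1 ≤ k ≤ ⌊n/2⌋ − 1`, the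
second column of `P(λ⁻)` has length exactly `2k + 1`, whence `k(λ) = ⌊q₂/2⌋ = k`.

Here `λ = λ₀ + zξ + ρ = (t₁, …, tₙ)` with `ξ = (1/2, …, 1/2)`,
`ρ = (n−1, n−2, …, 1, 0)`; `λ₀ = (λ₁, …, λₙ)` satisfies `λᵢ − λⱼ ∈ ℕ` (`i ≤ j`),
`2λᵢ ∈ ℤ` and `λ₁ + λ₂ = −2n + 3`; `hEHW` is the Enright–Howe–Wallach classification
(`Q(λ₀) = R(λ₀)` of type `su(1, q′)` with `z ≤ q′`, or of type `so*(2p)` with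
`λ₁ = ⋯ = λ_p = −n + 3/2 > λ_{p+1}` and `z ≤ p` (`p` odd), `z ≤ p − 1` (`p` even), or
`z = 2p − 3 − 2j`, `0 ≤ j ≤ ⌊p/2⌋ − 2`); `λ⁻ = (t₁, …, tₙ, −tₙ, …, −t₁)` and `q₂` is
the length of the second column of `P(λ⁻)`.  `kl` is the integer with
`V(L(λ)) = O̅_{k(λ)}`, a `K_ℂ`-orbit closure in `𝔭⁺`; by Bai–Xiao–Xie (`hAV_int`,
`hAV_gen`), `k(λ) = ⌊q₂/2⌋` if `t₁ ∈ ½ℤ` and `k(λ) = ⌊n/2⌋` otherwise. -/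
theorem unitary_associated_variety_SOstar
    (n : ℕ) (hn : 4 ≤ n)
    (lam0 : Fin n → ℝ)
    (hdec : ∀ i j : Fin n, i ≤ j → ∃ m : ℕ, lam0 i - lam0 j = (m : ℝ))
    (hhalf : ∀ i : Fin n, ∃ m : ℤ, 2 * lam0 i = (m : ℝ))
    -- normalization `(λ₀ + ρ, β^∨) = 0`
    (hnorm : lam0 ⟨0, by omega⟩ + lam0 ⟨1, by omega⟩ = -2 * (n : ℝ) + 3)
    -- `z = (λ, β^∨) = z_k = 2n − 3 − 2k`
    (z : ℝ) (k : ℕ) (hz : z = 2 * (n : ℝ) - 3 - 2 * k)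
    -- Enright–Howe–Wallach: `L(λ)` is unitarizable
    (hEHW :
      (∃ q' : ℕ, 1 ≤ q' ∧ q' ≤ n - 1 ∧
        (∀ i : Fin n, 1 ≤ (i : ℕ) → (i : ℕ) ≤ q' → lam0 i = lam0 ⟨1, by omega⟩) ∧
        lam0 ⟨1, by omega⟩ < lam0 ⟨0, by omega⟩ ∧
        (q' + 1 ≤ n - 1 → ∀ i : Fin n, (i : ℕ) = q' + 1 → lam0 i < lam0 ⟨1, by omega⟩) ∧
        z ≤ q') ∨
      (∃ p : ℕ, 3 ≤ p ∧ p ≤ n ∧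
        (∀ i : Fin n, (i : ℕ) < p → lam0 i = -(n : ℝ) + 3 / 2) ∧
        (p < n → ∀ i : Fin n, (i : ℕ) = p → lam0 i < -(n : ℝ) + 3 / 2) ∧
        ((Odd p ∧ z ≤ p) ∨ (Even p ∧ z ≤ (p : ℝ) - 1) ∨
          (∃ j : ℕ, j + 2 ≤ p / 2 ∧ z = 2 * (p : ℝ) - 3 - 2 * j))))
    -- `λ = λ₀ + zξ + ρ = (t₁, …, tₙ)`
    (t : Fin n → ℝ)
    (ht : ∀ i : Fin n, t i = lam0 i + z / 2 + ((n : ℝ) - 1 - (i : ℕ)))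
    -- `q₂` : the length of the second column of `P(λ⁻)`
    (q₂ : ℕ) (hq₂ : q₂ = RScol (minusSeq (List.ofFn t)) 2)
    -- `kl = k(λ)` : the integer with `V(L(λ)) = O̅_{k(λ)}` in `𝔭⁺` (Bai–Xiao–Xie)
    (kl : ℕ) (hkl : kl ≤ n / 2)
    (hAV_int : (∃ m : ℤ, 2 * t ⟨0, by omega⟩ = (m : ℝ)) → kl = q₂ / 2)
    (hAV_gen : ¬ (∃ m : ℤ, 2 * t ⟨0, by omega⟩ = (m : ℝ)) → kl = n / 2) :
    kl = min k (n / 2) ∧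
    (∀ p : ℕ, 3 ≤ p → p ≤ n →
      (∀ i : Fin n, (i : ℕ) < p → lam0 i = -(n : ℝ) + 3 / 2) →
      (p < n → ∀ i : Fin n, (i : ℕ) = p → lam0 i < -(n : ℝ) + 3 / 2) →
      (p : ℝ) - 1 ≤ z → z ≤ 2 * (p : ℝ) - 3 → 1 ≤ k → k ≤ n / 2 - 1 →
      q₂ = 2 * k + 1 ∧ q₂ / 2 = k) := by
  obtain rfl : z = 2 * (n : ℝ) - 3 - 2 * k := hz
  have hanti : ∀ i j : Fin n, i ≤ j → lam0 j ≤ lam0 i := fun i j hij => by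
    obtain ⟨m, hm⟩ := hdec i j hij
    have : (0 : ℝ) ≤ m := m.cast_nonneg
    linarith
  have ht_anti : StrictAnti t := by
    intro i j hij
    have h1 := hanti i j hij.le
    have h2 : ((i : ℕ) : ℝ) < ((j : ℕ) : ℝ) := by exact_mod_cast hij
    rw [ht, ht]
    linarith
  have hq : q₂ = min n (2 * k + 1) := by
    rw [hq₂]
    rcases hEHW with ⟨q, hq1, hqn, heq, hlt, -, hzq⟩ | ⟨p, hp3, hpn, heq, -, hzp⟩
    · have hzero : ∀ j : Fin n, 1 ≤ (j : ℕ) →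
          lam0 ⟨0, by omega⟩ + lam0 j ≤ -2 * (n : ℝ) + 3 := fun j hj => by
        have := hanti ⟨1, by omega⟩ j hj
        linarith
      refine RScol_two_minusSeq_ofFn t ht_anti (fun i j hij => ?_) fun hk => ?_
      · suffices lam0 i + lam0 j ≤ -2 * (n : ℝ) + 3 by
          rw [ht, ht]
          linarith
        rcases Nat.eq_zero_or_pos (i : ℕ) with hi | hi
        · rw [show i = ⟨0, by omega⟩ from Fin.ext hi]
          exact hzero j (by omega)
        · rcases Nat.eq_zero_or_pos (j : ℕ) with hj | hj
          · rw [show j = ⟨0, by omega⟩ from Fin.ext hj, add_comm]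
            exact hzero i hi
          · have := hanti ⟨1, by omega⟩ i hi
            have := hanti ⟨1, by omega⟩ j hj
            linarith
      · have hzq' : 2 * n ≤ q + 3 + 2 * k := by
          have : 2 * (n : ℝ) ≤ q + 3 + 2 * k := by linarith
          exact_mod_cast this
        refine ⟨⟨0, by omega⟩, ⟨2 * n - 3 - 2 * k, by omega⟩, by simp only; omega, ?_⟩
        rw [ht, ht, heq ⟨2 * n - 3 - 2 * k, by omega⟩ (by simp only; omega)
          (by simp only; omega)]
        have hcast : ((2 * n - 3 - 2 * k : ℕ) : ℝ) + 3 + 2 * k = 2 * n := by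
          norm_cast
          omega
        simp only [Nat.cast_zero]
        linarith
    · have hzp' : 2 * n ≤ 2 * p + 2 * k := by
        have hp : (3 : ℝ) ≤ p := by exact_mod_cast hp3
        have : 2 * (n : ℝ) ≤ 2 * p + 2 * k := by
          rcases hzp with ⟨-, h⟩ | ⟨-, h⟩ | ⟨j, -, h⟩
          · linarith
          · linarith
          · have : (0 : ℝ) ≤ j := j.cast_nonneg
            linarith
        exact_mod_cast this
      have hfst : ∀ i : Fin n, lam0 i ≤ -(n : ℝ) + 3 / 2 := fun i => by
        rw [← heq ⟨0, by omega⟩ (by simp only; omega)]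
        exact hanti _ _ (Nat.zero_le _)
      refine RScol_two_minusSeq_ofFn t ht_anti (fun i j _ => ?_) fun hk => ?_
      · have := hfst i
        have := hfst j
        rw [ht, ht]
        linarith
      · obtain ⟨a, b, ha, hb, hab⟩ : ∃ a b : ℕ, a < p ∧ b < p ∧ a + b + 2 * k + 3 = 2 * n :=
          ⟨n - k - 2, n - k - 1, by omega, by omega, by omega⟩
        refine ⟨⟨a, by omega⟩, ⟨b, by omega⟩, hab, ?_⟩
        rw [ht, ht, heq ⟨a, _⟩ ha, heq ⟨b, _⟩ hb]
        have hcast : (a : ℝ) + b + 2 * k + 3 = 2 * n := by exact_mod_cast hab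
        simp only
        linarith
  have hint : ∃ m : ℤ, 2 * t ⟨0, by omega⟩ = (m : ℝ) := by
    obtain ⟨m, hm⟩ := hhalf ⟨0, by omega⟩
    refine ⟨m + (2 * n - 3 - 2 * k) + 2 * (n - 1), ?_⟩
    rw [ht]
    push_cast
    linarith
  have hkl' := hAV_int hint
  refine ⟨by omega, fun p _ _ _ _ _ _ _ _ => ?_⟩
  omega
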